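/- Each s_i is an involution: s_i(s_i(x)) = x for every generator x ∈ {a_0,…,a_l, f_0,…,f_l}, and hence s_i∘s_i is the identity automorphism of F_cl. -/

import Mathlib

open MvPolynomial

/-- The field `F_cl = ℂ(a_0,…,a_l, f_0,…,f_l)` of rational functions in
`2(l+1)` commuting indeterminates. -/
abbrev Fcl (l : ℕ) : Type :=
  FractionRing (MvPolynomial (Fin (l + 1) ⊕ Fin (l + 1)) ℂ)

/-- The generator `a_j` of `F_cl`. -/
noncomputable def av (l : ℕ) (j : Fin (l + 1)) : Fcl l :=
  algebraMap (MvPolynomial (Fin (l + 1) ⊕ Fin (l + 1)) ℂ) (Fcl l) (X (Sum.inl j))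

/-- The generator `f_j` of `F_cl`. -/
noncomputable def fv (l : ℕ) (j : Fin (l + 1)) : Fcl l :=
  algebraMap (MvPolynomial (Fin (l + 1) ⊕ Fin (l + 1)) ℂ) (Fcl l) (X (Sum.inr j))

/-- The generalized Cartan matrix of affine type `A_l^(1)` (indices mod `l+1`). -/
def cartanA (l : ℕ) (i j : Fin (l + 1)) : ℤ :=
  if i = j then 2 else if j = i + 1 ∨ i = j + 1 then -1 else 0

/-- `u_{ij} = 1` if `j ≡ i+1`, `-1` if `j ≡ i-1`, `0` otherwise. -/
def uA (l : ℕ) (i j : Fin (l + 1)) : ℤ :=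
  if j = i + 1 then 1 else if i = j + 1 then -1 else 0

theorem av_ne_zero (l : ℕ) (j : Fin (l + 1)) : av l j ≠ 0 := by
  simp [av, X_ne_zero]

theorem av_add_fv_ne_zero (l : ℕ) (i : Fin (l + 1)) : av l i + fv l i ≠ 0 := by
  rw [av, fv, ← map_add, Ne, FaithfulSMul.algebraMap_eq_zero_iff]
  intro h
  simpa using congrArg (eval (fun _ => (1 : ℂ))) h

theorem one_add_av_mul_fv_ne_zero (l : ℕ) (i : Fin (l + 1)) : 1 + av l i * fv l i ≠ 0 := by
  rw [av, fv, ← map_mul,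
    ← map_one (algebraMap (MvPolynomial (Fin (l + 1) ⊕ Fin (l + 1)) ℂ) (Fcl l)),
    ← map_add, Ne, FaithfulSMul.algebraMap_eq_zero_iff]
  intro h
  simpa using congrArg (eval (fun _ => (0 : ℂ))) h

theorem uA_self {l : ℕ} (hl : l ≠ 0) (i : Fin (l + 1)) : uA l i i = 0 := by
  have : NeZero l := ⟨hl⟩
  simp [uA]

theorem cartanA_self (l : ℕ) (i : Fin (l + 1)) : cartanA l i i = 2 := by
  simp [cartanA]

/-- Algebra endomorphisms of `F_cl` agreeing on all generators are equal. -/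
theorem Fcl.algHom_ext {l : ℕ} {φ ψ : Fcl l →ₐ[ℂ] Fcl l}
    (ha : ∀ j, φ (av l j) = ψ (av l j)) (hf : ∀ j, φ (fv l j) = ψ (fv l j)) : φ = ψ := by
  apply AlgHom.coe_ringHom_injective
  apply IsLocalization.ringHom_ext
    (nonZeroDivisors (MvPolynomial (Fin (l + 1) ⊕ Fin (l + 1)) ℂ))
  apply MvPolynomial.ringHom_ext
  · intro c
    have hc : algebraMap (MvPolynomial (Fin (l + 1) ⊕ Fin (l + 1)) ℂ) (Fcl l) (C c) =
        algebraMap ℂ (Fcl l) c := by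
      rw [IsScalarTower.algebraMap_apply ℂ (MvPolynomial (Fin (l + 1) ⊕ Fin (l + 1)) ℂ) (Fcl l),
        algebraMap_eq]
    simp only [RingHom.comp_apply, RingHom.coe_coe, hc, AlgHom.commutes]
  · rintro (j | j)
    · exact ha j
    · exact hf j

/-- each `s_i` is an involution on the generators, and hence
`s_i ∘ s_i` is the identity automorphism of `F_cl`. -/
theorem KNY_involution (l : ℕ) (hl : 2 ≤ l)
    (s : Fin (l + 1) → (Fcl l →ₐ[ℂ] Fcl l))
    (hsa : ∀ i j, s i (av l j) = av l j * av l i ^ (-(cartanA l i j)))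
    (hsf : ∀ i j, s i (fv l j) =
      fv l j * ((av l i + fv l i) / (1 + av l i * fv l i)) ^ (uA l i j)) :
    (∀ i j, s i (s i (av l j)) = av l j ∧ s i (s i (fv l j)) = fv l j) ∧
    (∀ i, (s i).comp (s i) = AlgHom.id ℂ (Fcl l)) := by
  have ha : ∀ i, s i (av l i) = (av l i)⁻¹ := fun i => by
    have h := av_ne_zero l i
    rw [hsa, cartanA_self, zpow_neg]
    field_simp
  have hf : ∀ i, s i (fv l i) = fv l i := fun i => by
    rw [hsf, uA_self (by omega), zpow_zero, mul_one]
  have hsaa : ∀ i j, s i (s i (av l j)) = av l j := fun i j => by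
    have h := zpow_ne_zero (cartanA l i j) (av_ne_zero l i)
    rw [hsa, map_mul, map_zpow₀, hsa, ha, inv_zpow', neg_neg, zpow_neg,
      inv_mul_cancel_right₀ h]
  have hsff : ∀ i j, s i (s i (fv l j)) = fv l j := fun i j => by
    have h := av_ne_zero l i
    have h₁ := av_add_fv_ne_zero l i
    have h₂ := one_add_av_mul_fv_ne_zero l i
    have hq : ((av l i)⁻¹ + fv l i) / (1 + (av l i)⁻¹ * fv l i) =
        ((av l i + fv l i) / (1 + av l i * fv l i))⁻¹ := by
      rw [inv_div, ← mul_div_mul_left _ _ h, mul_add, mul_add, mul_inv_cancel₀ h,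
        mul_inv_cancel_left₀ h, mul_one]
    rw [hsf, map_mul, map_zpow₀, map_div₀, map_add, map_add, map_mul, map_one, ha, hf, hsf, hq,
      inv_zpow, mul_inv_cancel_right₀ (zpow_ne_zero _ (div_ne_zero h₁ h₂))]
  exact ⟨fun i j => ⟨hsaa i j, hsff i j⟩, fun i => Fcl.algHom_ext (hsaa i) (hsff i)⟩
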